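/- Let λ_0(n,s) = 2^{2s} Γ(n/2) Γ(1+s) / Γ((n-2s)/2) and H(n,s) = 2^{2s} Γ((n+2s)/4)^2 / Γ((n-2s)/4)^2. For every integer n with 1 ≤ n ≤ 7 and every s ∈ (0,1) with 2s < n, λ_0(n,s) > H(n,s). -/

import Mathlib

open Filter Topology in
theorem aux_tends (x : ℝ) : Tendsto (Real.GammaSeq x) atTop (𝓝 (Real.Gamma x)) :=
  Real.GammaSeq_tendsto_Gamma x

theorem aux_mono (x k s d : ℝ) (hx : 0 ≤ x) (hk : 0 ≤ k) (hs : 0 ≤ s) (hd : 0 ≤ d) :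
    (x+d+k)*(x+2*k+2*s+d)^2*((x+s+k)*(x+2*k)^2) ≤
      (x+k)*(x+2*k+2*s)^2*((x+s+d+k)*(x+2*k+d)^2) := by
  rw [← sub_nonneg]
  ring_nf
  positivity

theorem aux_e1 (a b s : ℝ) (ha : 0 < a) (hb : 0 < b) (hs : 0 < s)
    (h : s * (a + b) ≤ b * (b - a)) :
    (a + s) * b ≤ (b - s) * a * Real.exp (s / b + s / a) := by
  have hbs : 0 < b - s := by
    by_contra hc
    nlinarith
  have h1 := Real.quadratic_le_exp_of_nonneg (x := s / b + s / a) (by positivity)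
  refine le_trans ?_ (mul_le_mul_of_nonneg_left h1 (by positivity))
  rw [← sub_nonneg]
  have : (b - s) * a * (1 + (s / b + s / a) + (s / b + s / a) ^ 2 / 2) - (a + s) * b
      = s ^ 2 * (a + b) * (b * (b - a) - s * (a + b)) / (2 * a * b ^ 2) := by
    field_simp
    ring
  rw [this]
  have := sub_nonneg.2 h
  positivity

theorem aux_e2 (c s : ℝ) (hs : 0 < s) (hc : s < c) :
    Real.exp (s / c) * (c - s / 2) ≤ c + s / 2 := by
  obtain ⟨d, rfl⟩ : ∃ d, c = d + s / 2 := ⟨c - s / 2, by ring⟩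
  have h0 : 0 < d := by linarith
  rw [add_sub_cancel_right]
  have h1 := Real.le_log_one_add_of_nonneg (x := s / d) (by positivity)
  have h2 : 2 * (s / d) / (s / d + 2) = s / (d + s / 2) := by
    field_simp
    try ring
  rw [h2, Real.le_log_iff_exp_le (by positivity)] at h1
  calc _ ≤ (1 + s / d) * d := mul_le_mul_of_nonneg_right h1 h0.le
    _ = d + s / 2 + s / 2 := by field_simp; ring

noncomputable def auxC (k : ℕ) : ℝ := 2 / (7 / 4 + (k : ℝ)) - 1 / (7 / 2 + (k : ℝ)) - 1 / (1 + (k : ℝ))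

theorem aux_step (p s : ℝ) (j : ℕ) (hs : 0 < s) (hs1 : s < 1) (hsp : s < p) (hp : p ≤ 7 / 2) :
    Real.exp (s * auxC j) * ((p + j) * (1 + s + j) * ((p - s) / 2 + j) ^ 2)
      ≤ (p - s + j) * ((p + s) / 2 + j) ^ 2 * (1 + j) := by
  unfold auxC
  have hk : (0 : ℝ) ≤ j := Nat.cast_nonneg j
  generalize (j : ℝ) = k at *
  have h1 := aux_e1 (1 + k) (7 / 2 + k) s (by positivity) (by positivity) hs (by nlinarith)
  have h2 := aux_e2 (7 / 4 + k) s hs (by linarith)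
  have h3 := aux_mono (p - s) k s (7 / 2 - p) (by linarith) hk hs.le (by linarith)
  have hE : Real.exp (s * (2 / (7 / 4 + k) - 1 / (7 / 2 + k) - 1 / (1 + k)))
      * Real.exp (s / (7 / 2 + k) + s / (1 + k)) = Real.exp (s / (7 / 4 + k)) ^ 2 := by
    rw [← Real.exp_add, ← Real.exp_nat_mul]
    congr 1
    push_cast
    ring
  have hp1 := Real.exp_pos (s / (7 / 2 + k) + s / (1 + k))
  have hp2 := Real.exp_pos (s / (7 / 4 + k))
  have hp3 := Real.exp_pos (s * (2 / (7 / 4 + k) - 1 / (7 / 2 + k) - 1 / (1 + k)))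
  generalize Real.exp (s * (2 / (7 / 4 + k) - 1 / (7 / 2 + k) - 1 / (1 + k))) = E at *
  generalize Real.exp (s / (7 / 2 + k) + s / (1 + k)) = E1 at *
  generalize Real.exp (s / (7 / 4 + k)) = E2 at *
  have hc : 0 < 7 / 4 + k - s / 2 := by linarith
  have hb : 0 < 7 / 2 + k - s := by linarith
  have h2' : E2 ^ 2 * (7 / 4 + k - s / 2) ^ 2 ≤ (7 / 4 + k + s / 2) ^ 2 := by
    rw [← mul_pow]
    exact pow_le_pow_left₀ (by positivity) h2 2
  have hA : E * ((7 / 2 + k) * (1 + k + s) * (7 / 4 + k - s / 2) ^ 2) ≤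
      (7 / 2 + k - s) * (7 / 4 + k + s / 2) ^ 2 * (1 + k) := by
    calc E * ((7 / 2 + k) * (1 + k + s) * (7 / 4 + k - s / 2) ^ 2)
        = E * (7 / 4 + k - s / 2) ^ 2 * ((1 + k + s) * (7 / 2 + k)) := by ring
      _ ≤ E * (7 / 4 + k - s / 2) ^ 2 * ((7 / 2 + k - s) * (1 + k) * E1) :=
          mul_le_mul_of_nonneg_left h1 (by positivity)
      _ = (E * E1) * (7 / 4 + k - s / 2) ^ 2 * ((7 / 2 + k - s) * (1 + k)) := by ring
      _ = E2 ^ 2 * (7 / 4 + k - s / 2) ^ 2 * ((7 / 2 + k - s) * (1 + k)) := by rw [hE]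
      _ ≤ (7 / 4 + k + s / 2) ^ 2 * ((7 / 2 + k - s) * (1 + k)) :=
          mul_le_mul_of_nonneg_right h2' (by positivity)
      _ = _ := by ring
  have hpk : 0 ≤ p + k := by linarith
  have hB : (7 / 2 + k - s) * (7 / 4 + k + s / 2) ^ 2 * ((p + k) * ((p - s) / 2 + k) ^ 2) ≤
      (p - s + k) * ((p + s) / 2 + k) ^ 2 * ((7 / 2 + k) * (7 / 4 + k - s / 2) ^ 2) := by
    nlinarith [h3]
  have hM : 0 < (7 / 2 + k) * (7 / 4 + k - s / 2) ^ 2 := by positivity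
  refine le_of_mul_le_mul_right ?_ hM
  calc _ = E * ((7 / 2 + k) * (1 + k + s) * (7 / 4 + k - s / 2) ^ 2)
          * ((p + k) * ((p - s) / 2 + k) ^ 2) := by ring
    _ ≤ (7 / 2 + k - s) * (7 / 4 + k + s / 2) ^ 2 * (1 + k)
          * ((p + k) * ((p - s) / 2 + k) ^ 2) := mul_le_mul_of_nonneg_right hA (by positivity)
    _ = (7 / 2 + k - s) * (7 / 4 + k + s / 2) ^ 2 * ((p + k) * ((p - s) / 2 + k) ^ 2)
          * (1 + k) := by ring
    _ ≤ (p - s + k) * ((p + s) / 2 + k) ^ 2 * ((7 / 2 + k) * (7 / 4 + k - s / 2) ^ 2)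
          * (1 + k) := mul_le_mul_of_nonneg_right hB (by positivity)
    _ = _ := by ring

theorem auxC_nonneg (k : ℕ) (hk : 1 ≤ k) : 0 ≤ auxC k := by
  unfold auxC
  have hk : (1 : ℝ) ≤ k := by exact_mod_cast hk
  generalize (k : ℝ) = k at *
  have : 2 / (7 / 4 + k) - 1 / (7 / 2 + k) - 1 / (1 + k)
      = (k - 7 / 8) / ((7 / 4 + k) * (7 / 2 + k) * (1 + k)) := by
    field_simp
    ring
  rw [this]
  have : 0 ≤ k - 7 / 8 := by linarith
  positivity

theorem auxC_sum : 0 < ∑ j ∈ Finset.range 30, auxC j := by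
  simp only [auxC, Finset.sum_range_succ, Finset.sum_range_zero]
  norm_num

theorem auxC_le (N : ℕ) (hN : 30 ≤ N) :
    ∑ j ∈ Finset.range 30, auxC j ≤ ∑ j ∈ Finset.range N, auxC j := by
  refine Finset.sum_le_sum_of_subset_of_nonneg (Finset.range_mono hN) ?_
  intro i _ hi
  refine auxC_nonneg i ?_
  simp at hi
  omega

theorem aux_seq (p s : ℝ) (N : ℕ) (hN : 30 ≤ N) (hs : 0 < s) (hs1 : s < 1) (hsp : s < p)
    (hp : p ≤ 7 / 2) :
    Real.exp (s * ∑ j ∈ Finset.range 30, auxC j) *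
      (Real.GammaSeq (p - s) N * Real.GammaSeq ((p + s) / 2) N ^ 2 * Real.GammaSeq 1 N) ≤
      Real.GammaSeq p N * Real.GammaSeq (1 + s) N * Real.GammaSeq ((p - s) / 2) N ^ 2 := by
  have hN0 : (0 : ℝ) < N := by exact_mod_cast (by omega : 0 < N)
  have hQ : ∀ x : ℝ, 0 < x → 0 < ∏ j ∈ Finset.range (N + 1), (x + (j : ℝ)) := fun x hx =>
    Finset.prod_pos fun j _ => by positivity
  have hprod : Real.exp (s * ∑ j ∈ Finset.range 30, auxC j) *
      ((∏ j ∈ Finset.range (N + 1), (p + (j : ℝ))) * (∏ j ∈ Finset.range (N + 1), (1 + s + (j : ℝ)))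
        * (∏ j ∈ Finset.range (N + 1), ((p - s) / 2 + (j : ℝ))) ^ 2) ≤
      (∏ j ∈ Finset.range (N + 1), (p - s + (j : ℝ))) *
        (∏ j ∈ Finset.range (N + 1), ((p + s) / 2 + (j : ℝ))) ^ 2 *
        (∏ j ∈ Finset.range (N + 1), (1 + (j : ℝ))) := by
    have h1 := Finset.prod_le_prod (s := Finset.range (N + 1))
      (f := fun j : ℕ => Real.exp (s * auxC j) *
        ((p + j) * (1 + s + j) * ((p - s) / 2 + j) ^ 2))
      (g := fun j : ℕ => (p - s + j) * ((p + s) / 2 + j) ^ 2 * (1 + j))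
      (fun j _ => by
        have : 0 < p := by linarith
        positivity)
      (fun j _ => aux_step p s j hs hs1 hsp hp)
    simp only [Finset.prod_mul_distrib, Finset.prod_pow] at h1
    rw [← Real.exp_sum, ← Finset.mul_sum] at h1
    refine le_trans (mul_le_mul_of_nonneg_right ?_ ?_) h1
    · exact Real.exp_le_exp.2 (mul_le_mul_of_nonneg_left (auxC_le _ (by omega)) hs.le)
    · have := hQ p (by linarith)
      have := hQ (1 + s) (by linarith)
      positivity
  have hpow : (N : ℝ) ^ p * (N : ℝ) ^ (1 + s) * ((N : ℝ) ^ ((p - s) / 2)) ^ 2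
      = (N : ℝ) ^ (p - s) * ((N : ℝ) ^ ((p + s) / 2)) ^ 2 * (N : ℝ) ^ (1 : ℝ) := by
    simp only [pow_two, ← Real.rpow_add hN0]
    congr 1
    ring
  unfold Real.GammaSeq
  have q1 := hQ p (by linarith)
  have q2 := hQ (1 + s) (by linarith)
  have q3 := hQ ((p - s) / 2) (by linarith)
  have q4 := hQ (p - s) (by linarith)
  have q5 := hQ ((p + s) / 2) (by linarith)
  have q6 := hQ 1 (by linarith)
  generalize (∏ j ∈ Finset.range (N + 1), (p + (j : ℝ))) = Q1 at *
  generalize (∏ j ∈ Finset.range (N + 1), (1 + s + (j : ℝ))) = Q2 at *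
  generalize (∏ j ∈ Finset.range (N + 1), ((p - s) / 2 + (j : ℝ))) = Q3 at *
  generalize (∏ j ∈ Finset.range (N + 1), (p - s + (j : ℝ))) = Q4 at *
  generalize (∏ j ∈ Finset.range (N + 1), ((p + s) / 2 + (j : ℝ))) = Q5 at *
  generalize (∏ j ∈ Finset.range (N + 1), (1 + (j : ℝ))) = Q6 at *
  generalize Real.exp (s * ∑ j ∈ Finset.range 30, auxC j) = E at *
  have r4 := Real.rpow_pos_of_pos hN0 (p - s)
  have r5 := Real.rpow_pos_of_pos hN0 ((p + s) / 2)
  have r6 := Real.rpow_pos_of_pos hN0 1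
  have hF : (0 : ℝ) < (N.factorial : ℝ) := by positivity
  generalize (N.factorial : ℝ) = F at *
  generalize (N : ℝ) ^ p = R1 at *
  generalize (N : ℝ) ^ (1 + s) = R2 at *
  generalize (N : ℝ) ^ ((p - s) / 2) = R3 at *
  generalize (N : ℝ) ^ (p - s) = R4 at *
  generalize (N : ℝ) ^ ((p + s) / 2) = R5 at *
  generalize (N : ℝ) ^ (1 : ℝ) = R6 at *
  calc E * (R4 * F / Q4 * (R5 * F / Q5) ^ 2 * (R6 * F / Q6))
      = (R4 * R5 ^ 2 * R6) * F ^ 4 * (E * (Q1 * Q2 * Q3 ^ 2)) /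
          ((Q4 * Q5 ^ 2 * Q6) * (Q1 * Q2 * Q3 ^ 2)) := by field_simp
    _ ≤ (R4 * R5 ^ 2 * R6) * F ^ 4 * (Q4 * Q5 ^ 2 * Q6) /
          ((Q4 * Q5 ^ 2 * Q6) * (Q1 * Q2 * Q3 ^ 2)) := by gcongr
    _ = (R1 * R2 * R3 ^ 2) * F ^ 4 * (Q4 * Q5 ^ 2 * Q6) /
          ((Q4 * Q5 ^ 2 * Q6) * (Q1 * Q2 * Q3 ^ 2)) := by rw [hpow]
    _ = _ := by field_simp

theorem aux_main (p s : ℝ) (hs : 0 < s) (hs1 : s < 1) (hsp : s < p) (hp : p ≤ 7 / 2) :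
    Real.Gamma (p - s) * Real.Gamma ((p + s) / 2) ^ 2 <
      Real.Gamma p * Real.Gamma (1 + s) * Real.Gamma ((p - s) / 2) ^ 2 := by
  have hlim := le_of_tendsto_of_tendsto
    ((((aux_tends (p - s)).mul ((aux_tends ((p + s) / 2)).pow 2)).mul (aux_tends 1)).const_mul
      (Real.exp (s * ∑ j ∈ Finset.range 30, auxC j)))
    (((aux_tends p).mul (aux_tends (1 + s))).mul ((aux_tends ((p - s) / 2)).pow 2))
    (Filter.eventually_atTop.2 ⟨30, fun N hN => aux_seq p s N hN hs hs1 hsp hp⟩)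
  rw [Real.Gamma_one, mul_one] at hlim
  refine lt_of_lt_of_le ?_ hlim
  have h1 : 1 < Real.exp (s * ∑ j ∈ Finset.range 30, auxC j) :=
    Real.one_lt_exp_iff.2 (mul_pos hs auxC_sum)
  have h2 := Real.Gamma_pos_of_pos (sub_pos.2 hsp)
  have h3 := Real.Gamma_pos_of_pos (by linarith : 0 < (p + s) / 2)
  exact lt_mul_of_one_lt_left (by positivity) h1

theorem singular_solution_unstable_low_dim
    (n : ℕ) (hn1 : 1 ≤ n) (hn7 : n ≤ 7) (s : ℝ) (hs : 0 < s) (hs1 : s < 1)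
    (hns : 2 * s < (n : ℝ)) :
    2 ^ (2 * s) * Real.Gamma ((n : ℝ) / 2) * Real.Gamma (1 + s) / Real.Gamma (((n : ℝ) - 2 * s) / 2)
      > 2 ^ (2 * s) * Real.Gamma (((n : ℝ) + 2 * s) / 4) ^ 2 / Real.Gamma (((n : ℝ) - 2 * s) / 4) ^ 2 := by
  have hn : (n : ℝ) ≤ 7 := by exact_mod_cast hn7
  have h := aux_main ((n : ℝ) / 2) s hs hs1 (by linarith) (by linarith)
  rw [show (n : ℝ) / 2 - s = ((n : ℝ) - 2 * s) / 2 by ring,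
    show ((n : ℝ) / 2 + s) / 2 = ((n : ℝ) + 2 * s) / 4 by ring,
    show ((n : ℝ) - 2 * s) / 2 / 2 = ((n : ℝ) - 2 * s) / 4 by ring] at h
  have g1 := Real.Gamma_pos_of_pos (by linarith : 0 < ((n : ℝ) - 2 * s) / 2)
  have g2 := Real.Gamma_pos_of_pos (by linarith : 0 < ((n : ℝ) - 2 * s) / 4)
  have g3 : (0 : ℝ) < 2 ^ (2 * s) := by positivity
  rw [gt_iff_lt, div_lt_div_iff₀ (by positivity) g1]
  nlinarith [mul_lt_mul_of_pos_left h g3]
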